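/- Let R be an arithmetical ring such that (a) for every maximal ideal P, R_P is either coherent or not semicoherent, and (b) every finitely generated R-module has finite Goldie dimension. Then for each multiplicative subset S of R and each finitely injective R-module G, the localization S^{-1}G is a finitely injective S^{-1}R-module. -/

import Mathlib

universe u

/-- A ring is *coherent* if every finitely generated ideal is finitely presented. -/
def IsCoherentRing (R : Type u) [CommRing R] : Prop :=
  ∀ I : Ideal R, I.FG → Module.FinitePresentation R I

/-- A ring is *semicoherent* if `Hom_R(E, F)` is (isomorphic to) a submodule of a flat module
for every pair of injective modules `E`, `F`. -/
def IsSemicoherentRing (R : Type u) [CommRing R] : Prop :=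
  ∀ (E F : Type u) [AddCommGroup E] [Module R E] [AddCommGroup F] [Module R F],
    Module.Injective R E → Module.Injective R F →
      ∃ G : ModuleCat.{u} R, Module.Flat R G ∧
        ∃ i : (E →ₗ[R] F) →ₗ[R] G, Function.Injective i

/-- An `R`-module `E` is *FP-injective* if `Ext¹_R(F, E) = 0` for every finitely
presented `R`-module `F`. -/
def IsFPInjective (R : Type u) [CommRing R] (E : Type u) [AddCommGroup E] [Module R E] : Prop :=
  ∀ (F : Type u) [AddCommGroup F] [Module R F], Module.FinitePresentation R F →
    Subsingleton (((Ext R (ModuleCat.{u} R) 1).obj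
      (Opposite.op (ModuleCat.of R F))).obj (ModuleCat.of R E))

/-- A ring is an *IF-ring* if every injective module over it is flat. -/
def IsIFRing (R : Type u) [CommRing R] : Prop :=
  ∀ (M : Type u) [AddCommGroup M] [Module R M], Module.Injective R M → Module.Flat R M

/-- `f : M →ₗ[R] E` exhibits `E` as an injective hull of `M`: `E` is injective and
`f` embeds `M` as an essential submodule of `E`. -/
def IsInjectiveHull (R : Type u) [CommRing R] (M E : Type u) [AddCommGroup M] [Module R M]
    [AddCommGroup E] [Module R E] (f : M →ₗ[R] E) : Prop :=
  Module.Injective R E ∧ Function.Injective f ∧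
    ∀ N : Submodule R E, N ≠ ⊥ → N ⊓ LinearMap.range f ≠ ⊥

/-- A module is indecomposable if it is nonzero and not the direct sum
of two nonzero submodules. -/
def IsIndecomposableModule (R : Type u) [CommRing R] (M : Type u) [AddCommGroup M]
    [Module R M] : Prop :=
  Nontrivial M ∧ ∀ A B : Submodule R M, IsCompl A B → A = ⊥ ∨ B = ⊥

/-- A module has *finite Goldie dimension* if its injective hull is a finite direct
sum of indecomposable injective modules. -/
def HasFiniteGoldieDimension (R : Type u) [CommRing R] (M : Type u) [AddCommGroup M]
    [Module R M] : Prop :=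
  ∃ (E : ModuleCat.{u} R) (f : M →ₗ[R] E), IsInjectiveHull R M E f ∧
    ∃ (n : ℕ) (D : Fin n → Submodule R E), DirectSum.IsInternal D ∧
      ∀ i, Module.Injective R (D i) ∧ IsIndecomposableModule R (D i)

/-- A commutative ring is a *valuation ring* (uniserial) if its ideals are totally
ordered by inclusion. -/
def IsChainRing (R : Type u) [CommRing R] : Prop :=
  ∀ I J : Ideal R, I ≤ J ∨ J ≤ I

/-- A commutative ring is *arithmetical* if all its localizations at maximal ideals are
valuation rings. -/
def IsArithmetical (R : Type u) [CommRing R] : Prop :=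
  ∀ (P : Ideal R) (hP : P.IsMaximal),
    haveI := hP.isPrime
    IsChainRing (Localization.AtPrime P)

/-- An `R`-module `M` is *finitely injective* if every homomorphism `A → M` from a finitely
generated submodule `A` of an arbitrary module `B` extends to `B`. -/
def IsFinitelyInjective (R : Type u) [CommRing R] (M : Type u) [AddCommGroup M]
    [Module R M] : Prop :=
  ∀ (B : Type u) [AddCommGroup B] [Module R B] (A : Submodule R B), A.FG →
    ∀ f : A →ₗ[R] M, ∃ g : B →ₗ[R] M, ∀ a : A, g a = f a

/-- A domain has *finite character* if every nonzero element lies in only finitely many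
maximal ideals. -/
def FiniteCharacter (R : Type u) [CommRing R] : Prop :=
  ∀ r : R, r ≠ 0 → {P : Ideal R | P.IsMaximal ∧ r ∈ P}.Finite

section ChainPart

variable {A : Type u} [CommRing A]

/-- Solving compatible linear systems in one unknown in a Baer module over a chain ring. -/
theorem chain_solve (hA : ∀ a b : A, a ∣ b ∨ b ∣ a) {E : Type u} [AddCommGroup E] [Module A E]
    (hE : Module.Baer A E) {ι : Type u} (r : ι → A) (e : ι → E)
    (h : ∀ k l c, r k = c * r l → e k = c • e l) : ∃ y : E, ∀ k, r k • y = e k := by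
  classical
  rcases isEmpty_or_nonempty ι with hι | ⟨⟨k0⟩⟩
  · exact ⟨0, fun k => (hι.false k).elim⟩
  have hann : ∀ k c, c * r k = 0 → c • e k = 0 := by
    intro k c hc
    have := h k k (1 + c) (by rw [add_mul, hc]; ring)
    rw [add_smul, one_smul] at this
    simpa using this
  have hwd : ∀ k l c d, c * r k = d * r l → c • e k = d • e l := by
    intro k l c d hcd
    rcases hA (r k) (r l) with ⟨x, hx⟩ | ⟨x, hx⟩
    · have h1 := h l k x (by rw [hx]; ring)
      have h2 := hann k (c - d * x) (by rw [sub_mul, hcd, hx]; ring)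
      rw [sub_smul, sub_eq_zero] at h2
      rw [h1, h2, mul_smul]
    · have h1 := h k l x (by rw [hx]; ring)
      have h2 := hann l (d - c * x) (by rw [sub_mul, ← hcd, hx]; ring)
      rw [sub_smul, sub_eq_zero] at h2
      rw [h1, h2, mul_smul]
  let I : Ideal A :=
    { carrier := {z | ∃ k c, z = c * r k}
      zero_mem' := ⟨k0, 0, by ring⟩
      add_mem' := by
        rintro a b ⟨k, c, rfl⟩ ⟨l, d, rfl⟩
        rcases hA (r k) (r l) with ⟨x, hx⟩ | ⟨x, hx⟩
        · exact ⟨k, c + d * x, by rw [hx]; ring⟩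
        · exact ⟨l, c * x + d, by rw [hx]; ring⟩
      smul_mem' := by
        rintro a b ⟨k, c, rfl⟩
        exact ⟨k, a * c, by simp [mul_assoc]⟩ }
  choose K C hKC using fun z : I => z.2
  have key : ∀ (z : I) k c, (z : A) = c * r k → C z • e (K z) = c • e k := by
    intro z k c hz
    exact hwd _ _ _ _ ((hKC z).symm.trans hz)
  let f : I →ₗ[A] E :=
    { toFun := fun z => C z • e (K z)
      map_add' := by
        intro a b
        rcases hA (r (K a)) (r (K b)) with ⟨x, hx⟩ | ⟨x, hx⟩
        · rw [key (a + b) (K a) (C a + C b * x), key b (K a) (C b * x), add_smul]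
          · rw [hKC b, hx]; ring
          · push_cast
            rw [hKC b, hx]; nth_rewrite 1 [hKC a]; ring
        · rw [key (a + b) (K b) (C a * x + C b), key a (K b) (C a * x), add_smul]
          · rw [hKC a, hx]; ring
          · push_cast
            rw [hKC a, hx]; nth_rewrite 1 [hKC b]; ring
      map_smul' := by
        intro c a
        rw [key (c • a) (K a) (c * C a), mul_smul]; · rfl
        show c * (a : A) = _
        nth_rewrite 1 [hKC a]; ring }
  obtain ⟨g, hg⟩ := hE I f
  refine ⟨g 1, fun k => ?_⟩
  have hk : r k ∈ I := ⟨k, 1, by ring⟩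
  have := hg (r k) hk
  rw [← map_smul, smul_eq_mul, mul_one, this]
  show C ⟨r k, hk⟩ • e (K ⟨r k, hk⟩) = _
  rw [key ⟨r k, hk⟩ k 1 (by simp), one_smul]

theorem chain_solve_one (hA : ∀ a b : A, a ∣ b ∨ b ∣ a) {E : Type u} [AddCommGroup E] [Module A E]
    (hE : Module.Baer A E) (a : A) (x : E) (h : ∀ b, b * a = 0 → b • x = 0) :
    ∃ y : E, a • y = x := by
  obtain ⟨y, hy⟩ := chain_solve hA hE (ι := PUnit) (fun _ => a) (fun _ => x) (by
    intro _ _ c hc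
    have := h (1 - c) (by rw [sub_mul, ← hc]; ring)
    rw [sub_smul, one_smul, sub_eq_zero] at this
    exact this)
  exact ⟨y, hy ⟨⟩⟩

/-- The data of a localization map at the complement of an ideal `J`. -/
structure LocMap (J : Ideal A) {E M : Type u} [AddCommGroup E] [Module A E]
    [AddCommGroup M] [Module A M] (g : E →ₗ[A] M) : Prop where
  inj : ∀ s, s ∉ J → ∀ m : M, s • m = 0 → m = 0
  surj : ∀ s, s ∉ J → ∀ m : M, ∃ m', s • m' = m
  ker : ∀ e, g e = 0 → ∃ s, s ∉ J ∧ s • e = 0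
  frac : ∀ m, ∃ s, s ∉ J ∧ ∃ e, s • m = g e

theorem chain_baer_of_princ (hA : ∀ a b : A, a ∣ b ∨ b ∣ a) {E M : Type u} [AddCommGroup E]
    [Module A E] [AddCommGroup M] [Module A M] (hE : Module.Baer A E) (J : Ideal A)
    (hJ : ∀ s t, s ∉ J → t ∉ J → s * t ∉ J) (g : E →ₗ[A] M) (hg : LocMap J g)
    (hN : ∀ e : E, (∀ j ∈ J, j • e = 0) → ∃ s, s ∉ J ∧ s • e = 0)
    (hp : ∀ (a : A) (x : E), (∀ s, s ∉ J → s * a ≠ 0) →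
      (∀ b, b * a = 0 → ∀ j ∈ J, j • (b • x) = 0) → ∃ s, s ∉ J ∧ ∀ b, b * a = 0 → b • (s • x) = 0) :
    Module.Baer A M := by
  have hkill : ∀ s, s ∉ J → ∀ j ∈ J, ∀ e : E, s • e = 0 → j • e = 0 := by
    intro s hs j hj e he
    rcases hA s j with ⟨c, rfl⟩ | ⟨c, rfl⟩
    · rw [mul_comm, mul_smul, he, smul_zero]
    · exact (hs (J.mul_mem_right _ hj)).elim
  have hker : ∀ e : E, g e = 0 → ∀ j ∈ J, j • e = 0 := by
    intro e he j hj
    obtain ⟨s, hs, hse⟩ := hg.ker e he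
    exact hkill s hs j hj e hse
  have hker' : ∀ e : E, (∀ j ∈ J, j • e = 0) → g e = 0 := by
    intro e he
    obtain ⟨s, hs, hse⟩ := hN e he
    exact hg.inj s hs _ (by rw [← map_smul, hse, map_zero])
  intro I f
  suffices h : ∃ y : M, ∀ i : I, f i = (i : A) • y by
    obtain ⟨y, hy⟩ := h
    exact ⟨LinearMap.toSpanSingleton A M y, fun x hx => by simp [hy]⟩
  have fz : ∀ i : I, (∃ s, s ∉ J ∧ s * (i : A) = 0) → f i = 0 := by
    rintro i ⟨s, hs, hsi⟩
    apply hg.inj s hs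
    rw [← map_smul]
    have : s • i = 0 := Subtype.ext hsi
    rw [this, map_zero]
  have step1 : ∀ i : I, ∃ y : M, f i = (i : A) • y := by
    intro i
    by_cases hi : ∃ s, s ∉ J ∧ s * (i : A) = 0
    · exact ⟨0, by rw [fz i hi, smul_zero]⟩
    push Not at hi
    obtain ⟨s0, hs0, x, hx⟩ := hg.frac (f i)
    obtain ⟨s, hs, hsx⟩ := hp i x hi (by
      intro b hb
      apply hker
      rw [map_smul, ← hx, smul_comm, ← map_smul f]
      have : b • i = 0 := Subtype.ext hb
      rw [this, map_zero, smul_zero])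
    obtain ⟨e, he⟩ := chain_solve_one hA hE i (s • x) hsx
    obtain ⟨y, hy⟩ := hg.surj (s * s0) (hJ _ _ hs hs0) (g e)
    refine ⟨y, ?_⟩
    rw [← sub_eq_zero]
    apply hg.inj (s * s0) (hJ _ _ hs hs0)
    rw [smul_sub, smul_comm _ (i : A), hy, ← map_smul g, he, map_smul, ← hx, mul_smul, sub_self]
  by_cases hall : ∀ i : I, ∃ s, s ∉ J ∧ s * (i : A) = 0
  · exact ⟨0, fun i => by rw [fz i (hall i), smul_zero]⟩
  push Not at hall
  obtain ⟨i0, hi0⟩ := hall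
  obtain ⟨y0, hy0⟩ := step1 i0
  have step2 : ∀ z : M, (i0 : A) • z = 0 → ∃ e, z = g e := by
    intro z hz
    obtain ⟨s, hs, e, he⟩ := hg.frac z
    have hie : g ((i0 : A) • e) = 0 := by rw [map_smul, ← he, smul_comm, hz, smul_zero]
    have hsj : ∀ j, s * j = 0 → j • e = 0 := by
      intro j hj
      rcases hA i0 j with ⟨c, rfl⟩ | ⟨c, hc⟩
      · have hcJ : c ∈ J := by
          by_contra hcJ
          exact hi0 (s * c) (hJ _ _ hs hcJ) (by rw [← hj]; ring)
        rw [mul_comm, mul_smul]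
        exact hker _ hie c hcJ
      · exact (hi0 s hs (by rw [hc, ← mul_assoc, hj, zero_mul])).elim
    obtain ⟨e', he'⟩ := chain_solve hA hE (ι := J) (fun j => s * j) (fun j => (j : A) • e) (by
      intro k l c hc
      have := hsj ((k : A) - c * l) (by rw [mul_sub, hc]; ring)
      rw [sub_smul, sub_eq_zero, mul_smul] at this
      exact this)
    refine ⟨e', ?_⟩
    rw [← sub_eq_zero]
    apply hg.inj s hs
    rw [smul_sub, he, ← map_smul, ← map_sub]
    apply hker'
    intro j hj
    have := he' ⟨j, hj⟩
    simp only at this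
    rw [smul_sub, ← this, smul_smul, mul_comm, sub_self]
  have step3 : ∀ i : I, ∃ e : E, f i = (i : A) • (g e + y0) := by
    intro i
    rcases hA i0 i with ⟨c, hc⟩ | ⟨c, hc⟩
    · refine ⟨0, ?_⟩
      have : i = c • i0 := Subtype.ext (by rw [hc]; simp [mul_comm])
      rw [map_zero, zero_add, this, map_smul, hy0]
      simp [mul_smul]
    · obtain ⟨y, hy⟩ := step1 i
      have : i0 = c • i := Subtype.ext (by rw [hc]; simp [mul_comm])
      obtain ⟨e, he⟩ := step2 (y - y0) (by
        rw [smul_sub, ← hy0, this, map_smul, hy]; simp [mul_smul])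
      exact ⟨e, by rw [← he, hy]; simp⟩
  choose e he using step3
  have hdiff : ∀ i k : I, ∀ d : A, (i : A) = k * d → ∀ j ∈ J, j • ((i : A) • (e i - e k)) = 0 := by
    intro i k d hd
    apply hker
    have h1 : i = d • k := Subtype.ext (by rw [hd]; simp [mul_comm])
    have h2 : f i = (i : A) • (g (e k) + y0) := by
      conv_lhs => rw [h1, map_smul, he k, smul_smul, mul_comm, ← hd]
    have h3 := he i
    rw [h2, smul_add, smul_add, add_left_inj] at h3
    rw [map_smul, map_sub, smul_sub, h3, sub_self]
  obtain ⟨y, hy⟩ := chain_solve hA hE (ι := I × J) (fun p => (p.2 : A) * p.1)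
    (fun p => (p.2 : A) • ((p.1 : A) • e p.1)) (by
      rintro ⟨i, j⟩ ⟨k, l⟩ c hc
      simp only at hc ⊢
      rcases hA i k with ⟨d, hd⟩ | ⟨d, hd⟩
      · have := hdiff k i d hd l l.2
        rw [smul_sub, smul_sub, sub_eq_zero] at this
        rw [this, smul_smul, smul_smul, smul_smul, hc, mul_assoc]
      · have := hdiff i k d hd j j.2
        rw [smul_sub, smul_sub, sub_eq_zero] at this
        rw [this, smul_smul, smul_smul, smul_smul, hc, mul_assoc])
  refine ⟨g y + y0, fun i => ?_⟩
  have : g ((i : A) • (y - e i)) = 0 := by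
    apply hker'
    intro j hj
    have := hy (i, ⟨j, hj⟩)
    simp only [mul_smul] at this
    rw [smul_sub, smul_sub, this, sub_self]
  rw [he i, smul_add, smul_add, add_left_inj, ← sub_eq_zero, ← neg_eq_zero, ← this, map_smul,
    map_sub, smul_sub]
  abel

end ChainPart
section SemicoherentPart

open TensorProduct in
theorem chain_flat {Q : Type u} [CommRing Q] (hQ : ∀ a b : Q, a ∣ b ∨ b ∣ a) {M : Type u}
    [AddCommGroup M] [Module Q M]
    (h : ∀ (c : Q) (x : M), c • x = 0 → ∃ d m, d * c = 0 ∧ x = d • m) : Module.Flat Q M := by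
  rw [Module.Flat.iff_lift_lsmul_comp_subtype_injective]
  intro I _
  rw [injective_iff_map_eq_zero]
  have hpure : ∀ x : I ⊗[Q] M, ∃ i m, x = i ⊗ₜ[Q] m := by
    intro x
    induction x using TensorProduct.induction_on with
    | zero => exact ⟨0, 0, by simp⟩
    | tmul i m => exact ⟨i, m, rfl⟩
    | add x y hx hy =>
      obtain ⟨i, m, rfl⟩ := hx
      obtain ⟨k, n, rfl⟩ := hy
      rcases hQ i k with ⟨d, hd⟩ | ⟨d, hd⟩
      · have : k = d • i := Subtype.ext (by rw [hd]; simp [mul_comm])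
        exact ⟨i, m + d • n, by rw [this, TensorProduct.smul_tmul, TensorProduct.tmul_add]⟩
      · have : i = d • k := Subtype.ext (by rw [hd]; simp [mul_comm])
        exact ⟨k, d • m + n, by rw [this, TensorProduct.smul_tmul, TensorProduct.tmul_add]⟩
  intro x hx
  obtain ⟨i, m, rfl⟩ := hpure x
  have hx' : (i : Q) • m = 0 := by simpa using hx
  obtain ⟨d, n, hd, rfl⟩ := h i m hx'
  have : d • i = 0 := Subtype.ext hd
  rw [← TensorProduct.smul_tmul, this, TensorProduct.zero_tmul]

theorem chain_injective_flat {Q : Type u} [CommRing Q] (hQ : ∀ a b : Q, a ∣ b ∨ b ∣ a)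
    (hz : ∀ t : Q, IsUnit t ∨ ∃ r, r ≠ 0 ∧ t * r = 0) (a b : Q) (ha : a ≠ 0) (hb : b ≠ 0)
    (hba : b * a = 0) (hann : ∀ b', b' * a = 0 → b ∣ b') {M : Type u}
    [AddCommGroup M] [Module Q M] (hM : Module.Baer Q M) : Module.Flat Q M := by
  apply chain_flat hQ
  intro c x hcx
  by_cases hc : c = 0
  · exact ⟨1, x, by simp [hc], by simp⟩
  have hd : ∃ d, d * c = 0 ∧ ∀ z, z * c = 0 → d ∣ z := by
    rcases hQ a c with ⟨d, rfl⟩ | ⟨d, rfl⟩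
    · rcases hQ b d with ⟨e, rfl⟩ | ⟨e, rfl⟩
      · exact (hc (by rw [← mul_assoc, mul_comm a, hba, zero_mul])).elim
      · refine ⟨e, by rw [← hba]; ring, fun z hzz => ?_⟩
        obtain ⟨w, hw⟩ := hann (z * d) (by rw [← hzz]; ring)
        rcases hQ e (z - e * w) with ⟨v, hv⟩ | ⟨v, hv⟩
        · exact ⟨w + v, by rw [mul_add, ← hv]; ring⟩
        · exfalso
          apply hb
          have : (z - e * w) * d = 0 := by rw [sub_mul, hw]; ring
          rw [hv, mul_comm d, mul_right_comm, this, zero_mul]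
    · refine ⟨d * b, by rw [← hba]; ring, fun z hzz => ?_⟩
      rcases hQ d z with ⟨w, rfl⟩ | ⟨w, rfl⟩
      · obtain ⟨v, rfl⟩ := hann w (by rw [← hzz]; ring)
        exact ⟨v, by ring⟩
      · exact (ha (by rw [← mul_assoc, mul_comm c, hzz, zero_mul])).elim
  obtain ⟨d, hdc, hd⟩ := hd
  obtain ⟨m, hm⟩ := chain_solve_one hQ hM d x (by
    intro z hzd
    suffices c ∣ z by
      obtain ⟨w, rfl⟩ := this
      rw [mul_comm, mul_smul, hcx, smul_zero]
    rcases hQ c z with h | ⟨p, hp⟩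
    · exact h
    rcases hz p with hu | ⟨r, hr, hpr⟩
    · obtain ⟨u, rfl⟩ := hu
      exact ⟨(u⁻¹ : Qˣ), by rw [hp, mul_assoc, Units.mul_inv, mul_one]⟩
    · exfalso
      rcases hQ z r with ⟨w, rfl⟩ | ⟨w, rfl⟩
      · obtain ⟨v, rfl⟩ := hd w (by rw [hp, ← hpr]; ring)
        exact hr (by rw [← mul_assoc, hzd, zero_mul])
      · exact hc (by rw [hp, mul_assoc, mul_comm w, ← mul_assoc, mul_comm r, hpr, zero_mul]))
  exact ⟨d, m, hdc, hm.symm⟩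

open CategoryTheory in
theorem exists_injective_embedding (Q : Type u) [CommRing Q] (M : Type u) [AddCommGroup M]
    [Module Q M] : ∃ (N : Type u) (_ : AddCommGroup N) (_ : Module Q N),
      Module.Injective Q N ∧ ∃ i : M →ₗ[Q] N, Function.Injective i := by
  refine ⟨(Injective.under (ModuleCat.of Q M) : ModuleCat.{u} Q), inferInstance, inferInstance, ?_,
    (Injective.ι (ModuleCat.of Q M)).hom, ?_⟩
  · rw [Module.injective_iff_injective_object]
    exact inferInstanceAs (Injective (Injective.under (ModuleCat.of Q M)))
  · exact (ModuleCat.mono_iff_injective _).1 inferInstance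

theorem chain_semicoherent {A : Type u} [CommRing A] (hA : ∀ a b : A, a ∣ b ∨ b ∣ a)
    (J : Ideal A) [hJ : J.IsPrime] (hJ1 : ∀ t, t ∉ J → ∀ r, t * r = 0 → r = 0)
    (hJ2 : ∀ t ∈ J, ∃ r, r ≠ 0 ∧ t * r = 0) (a b : A) (ha : a ≠ 0) (hb : b ≠ 0) (hba : b * a = 0)
    (hann : ∀ b', b' * a = 0 → ∃ s, s ∉ J ∧ ∃ c, s * b' = c * b) : IsSemicoherentRing A := by
  let Q := Localization.AtPrime J
  have hle : J.primeCompl ≤ nonZeroDivisors A := by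
    intro s hs
    rw [mem_nonZeroDivisors_iff_right]
    intro x hx
    exact hJ1 s hs x (by rw [mul_comm]; exact hx)
  have hinj : Function.Injective (algebraMap A Q) := IsLocalization.injective Q hle
  have hne : ∀ x : A, x ≠ 0 → algebraMap A Q x ≠ 0 := fun x hx h =>
    hx (hinj (by rw [h, map_zero]))
  have hunit : ∀ s, s ∉ J → IsUnit (algebraMap A Q s) := fun s hs =>
    IsLocalization.map_units Q (⟨s, hs⟩ : J.primeCompl)
  have hrep : ∀ q : Q, ∃ x : A, ∃ v : Qˣ, q = algebraMap A Q x * v := by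
    intro q
    obtain ⟨⟨x, s⟩, hx⟩ := IsLocalization.surj J.primeCompl q
    obtain ⟨v, hv⟩ := IsLocalization.map_units Q s
    refine ⟨x, v⁻¹, ?_⟩
    simp only at hx
    rw [← hx, ← hv, mul_assoc, Units.mul_inv, mul_one]
  have hQ : ∀ q q' : Q, q ∣ q' ∨ q' ∣ q := by
    intro q q'
    obtain ⟨x, v, rfl⟩ := hrep q
    obtain ⟨y, w, rfl⟩ := hrep q'
    simp only [Units.mul_right_dvd, Units.dvd_mul_right]
    exact (hA x y).imp (map_dvd _) (map_dvd _)
  have hz : ∀ t : Q, IsUnit t ∨ ∃ r, r ≠ 0 ∧ t * r = 0 := by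
    intro t
    obtain ⟨x, v, rfl⟩ := hrep t
    by_cases hx : x ∈ J
    · obtain ⟨r, hr, hxr⟩ := hJ2 x hx
      exact Or.inr ⟨algebraMap A Q r, hne r hr, by
        rw [mul_right_comm, ← map_mul, hxr, map_zero, zero_mul]⟩
    · exact Or.inl ((hunit x hx).mul v.isUnit)
  have hflat : ∀ (M : Type u) [AddCommGroup M] [Module Q M], Module.Baer Q M → Module.Flat Q M := by
    intro M _ _ hM
    refine chain_injective_flat hQ hz (algebraMap A Q a) (algebraMap A Q b) (hne a ha) (hne b hb)
      (by rw [← map_mul, hba, map_zero]) ?_ hM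
    intro q hq
    obtain ⟨x, v, rfl⟩ := hrep q
    rw [Units.dvd_mul_right]
    rw [mul_right_comm, Units.mul_left_eq_zero, ← map_mul] at hq
    obtain ⟨s, hs, c, hc⟩ := hann x (hinj (by rw [hq, map_zero]))
    have : algebraMap A Q b ∣ algebraMap A Q s * algebraMap A Q x := by
      rw [← map_mul, hc, map_mul]; exact dvd_mul_left _ _
    exact ((hunit s hs).dvd_mul_left).1 this
  intro E F _ _ _ _ hE hF
  have hE' : Module.Baer A E := Module.Baer.of_injective hE
  obtain ⟨N, _, _, hN, i, hi⟩ :=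
    exists_injective_embedding Q (LocalizedModule J.primeCompl (E →ₗ[A] F))
  let _ : Module A N := Module.compHom N (algebraMap A Q)
  have : IsScalarTower A Q N := IsScalarTower.of_algebraMap_smul fun _ _ => rfl
  have : Module.Flat Q N := hflat N (Module.Baer.of_injective hN)
  have : Module.Flat A Q := IsLocalization.flat Q J.primeCompl
  refine ⟨ModuleCat.of A N, Module.Flat.trans A Q N,
    (i.restrictScalars A) ∘ₗ LocalizedModule.mkLinearMap J.primeCompl (E →ₗ[A] F), ?_⟩
  refine Function.Injective.comp (g := i) hi ?_
  rw [injective_iff_map_eq_zero]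
  intro f hf
  rw [IsLocalizedModule.eq_zero_iff J.primeCompl] at hf
  obtain ⟨s, hs⟩ := hf
  ext e
  obtain ⟨e', rfl⟩ := chain_solve_one hA hE' (s : A) e (by
    intro b hb
    rw [hJ1 s s.2 b (by rw [mul_comm]; exact hb), zero_smul])
  rw [map_smul, ← LinearMap.smul_apply]
  exact congrArg (fun f => f e') hs

theorem chain_not_coherent {A : Type u} [CommRing A] (hA : ∀ a b : A, a ∣ b ∨ b ∣ a)
    (a b s : A) (ha : a ≠ 0) (hb : b ≠ 0) (hba : b * a = 0) (hs : ¬ IsUnit s)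
    (hs' : ∀ r, s * r = 0 → r = 0) : ¬ IsCoherentRing A := by
  intro hcoh
  have : Nontrivial A := ⟨⟨b, 0, hb⟩⟩
  have hloc : ∀ x, IsUnit (1 - s * x) := by
    intro x
    rcases hA (s * x) (1 - s * x) with ⟨y, hy⟩ | ⟨y, hy⟩
    · exact (hs (IsUnit.of_mul_eq_one (x * (1 + y)) (by linear_combination -hy))).elim
    · exact IsUnit.of_mul_eq_one (1 + y) (by linear_combination -hy)
  have hfp := hcoh (Ideal.span {a}) ⟨{a}, by simp⟩
  let f : A →ₗ[A] Ideal.span {a} :=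
    LinearMap.toSpanSingleton A _ ⟨a, Ideal.mem_span_singleton_self a⟩
  have hf : Function.Surjective f := by
    rintro ⟨x, hx⟩
    obtain ⟨c, hc⟩ := Ideal.mem_span_singleton'.1 hx
    exact ⟨c, Subtype.ext hc⟩
  have hfg : (LinearMap.ker f).FG := Module.FinitePresentation.fg_ker f hf
  have hmem : ∀ x, x ∈ LinearMap.ker f ↔ x * a = 0 := by
    intro x
    rw [LinearMap.mem_ker, ← Subtype.coe_inj]
    rfl
  -- ker f = s • ker f, so Nakayama
  have hnak : LinearMap.ker f = ⊥ := by
    refine Submodule.eq_bot_of_le_smul_of_le_jacobson_bot (Ideal.span {s}) _ hfg ?_ ?_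
    · intro x hx
      rw [hmem] at hx
      rcases hA s x with ⟨y, rfl⟩ | ⟨y, hy⟩
      · refine Submodule.smul_mem_smul (Ideal.mem_span_singleton_self s) ((hmem y).2 (hs' _ ?_))
        rw [← hx]; ring
      · exact (ha (hs' a (by rw [hy, mul_right_comm, hx, zero_mul]))).elim
    · rw [Ideal.span_singleton_le_iff_mem, Ideal.mem_jacobson_bot]
      intro y
      have := hloc (-y)
      convert this using 1; ring
  exact hb ((Submodule.mem_bot A).1 (hnak ▸ (hmem b).2 hba))

end SemicoherentPart
section ChainMain

theorem chain_main {A : Type u} [CommRing A] (hA : ∀ a b : A, a ∣ b ∨ b ∣ a)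
    (hcs : IsCoherentRing A ∨ ¬ IsSemicoherentRing A) {E M : Type u} [AddCommGroup E]
    [Module A E] [AddCommGroup M] [Module A M] (hE : Module.Baer A E)
    (hU : ∀ e e' : E, e ≠ 0 → e' ≠ 0 → ∃ r r' : A, r • e = r' • e' ∧ r • e ≠ 0)
    (J : Ideal A) [hJp : J.IsPrime] (g : E →ₗ[A] M) (hg : LocMap J g) : Module.Baer A M := by
  have hJ : ∀ s t, s ∉ J → t ∉ J → s * t ∉ J := fun s t hs ht => hJp.mul_notMem hs ht
  by_cases hall : ∀ s, s ∉ J → ∀ e : E, s • e = 0 → e = 0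
  · -- the localization map is bijective
    have hbij : Function.Bijective g := by
      constructor
      · rw [injective_iff_map_eq_zero]
        intro e he
        obtain ⟨s, hs, hse⟩ := hg.ker e he
        exact hall s hs e hse
      · intro m
        obtain ⟨s, hs, e, he⟩ := hg.frac m
        obtain ⟨e', rfl⟩ := chain_solve_one hA hE s e (by
          intro b hb
          apply hall s hs
          rw [smul_smul, mul_comm, hb, zero_smul])
        refine ⟨e', ?_⟩
        rw [eq_comm, ← sub_eq_zero]
        apply hg.inj s hs
        rw [smul_sub, he, map_smul, sub_self]
    exact Module.Baer.of_equiv (LinearEquiv.ofBijective g hbij) hE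
  push Not at hall
  obtain ⟨s0, hs0, e0, hse0, he0⟩ := hall
  have hN : ∀ e : E, (∀ j ∈ J, j • e = 0) → ∃ s, s ∉ J ∧ s • e = 0 := by
    intro e he
    by_cases h0 : e = 0
    · exact ⟨s0, hs0, by rw [h0, smul_zero]⟩
    obtain ⟨r, r', hr, hne⟩ := hU e e0 h0 he0
    refine ⟨s0 * r, hJ _ _ hs0 (fun hrJ => hne (he r hrJ)), ?_⟩
    rw [mul_smul, hr, smul_comm, hse0, smul_zero]
  apply chain_baer_of_princ hA hE J hJ g hg hN
  intro a x ha hx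
  have h1J : (1 : A) ∉ J := fun h => hJp.ne_top ((Ideal.eq_top_iff_one _).2 h)
  have ha0 : a ≠ 0 := by simpa using ha 1 h1J
  by_cases hc1 : ∃ t, t ∉ J ∧ ∃ r, r ≠ 0 ∧ t * r = 0
  · obtain ⟨t, ht, r, hr, htr⟩ := hc1
    rcases hA a r with ⟨j, rfl⟩ | ⟨j, rfl⟩
    · obtain ⟨s, hs, hsx⟩ := hN ((t * j) • x) (hx (t * j) (by rw [← htr]; ring))
      refine ⟨s * t, hJ _ _ hs ht, fun b hb => ?_⟩
      rcases hA b j with ⟨c, rfl⟩ | ⟨c, rfl⟩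
      · exact (hr (by rw [← mul_assoc, mul_comm a, hb, zero_mul])).elim
      · rw [smul_smul] at hsx ⊢
        rw [show j * c * (s * t) = c * (s * (t * j)) by ring, mul_smul, hsx, smul_zero]
    · exact (ha t ht (by rw [← mul_assoc, htr, zero_mul])).elim
  have hJ1 : ∀ t, t ∉ J → ∀ r, t * r = 0 → r = 0 := by
    intro t ht r htr
    by_contra hr
    exact hc1 ⟨t, ht, r, hr, htr⟩
  refine ⟨1, h1J, fun b hb => ?_⟩
  rw [one_smul]
  by_contra hbx
  have hb0 : b ≠ 0 := by
    rintro rfl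
    exact hbx (zero_smul _ _)
  by_cases hc2 : ∃ t ∈ J, ∀ r, t * r = 0 → r = 0
  · obtain ⟨t, ht, htr⟩ := hc2
    rcases hA t b with ⟨c, rfl⟩ | ⟨c, rfl⟩
    · apply hbx
      rw [mul_smul]
      exact hx c (htr _ (by rw [← hb]; ring)) t ht
    · exact ha0 (htr _ (by rw [mul_right_comm, hb, zero_mul]))
  have hJ2 : ∀ t ∈ J, ∃ r, r ≠ 0 ∧ t * r = 0 := by
    intro t ht
    by_contra h
    apply hc2
    refine ⟨t, ht, fun r hr => ?_⟩
    by_contra h0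
    exact h ⟨r, h0, hr⟩
  have hann : ∀ b', b' * a = 0 → ∃ s, s ∉ J ∧ ∃ c, s * b' = c * b := by
    intro b' hb'
    rcases hA b b' with ⟨c, rfl⟩ | ⟨c, rfl⟩
    · exact ⟨1, h1J, c, by ring⟩
    · refine ⟨c, fun hcJ => hbx ?_, 1, by ring⟩
      rw [mul_comm, mul_smul]
      exact hx b' hb' c hcJ
  rcases hcs with h | h
  · refine chain_not_coherent hA a b s0 ha0 hb0 hb ?_ (hJ1 s0 hs0) h
    rintro ⟨v, rfl⟩
    apply he0
    have := congrArg (fun z => (↑v⁻¹ : A) • z) hse0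
    simpa [smul_smul] using this
  · exact h (chain_semicoherent hA J hJ1 hJ2 a b ha0 hb0 hb hann)

theorem chain_dvd {A : Type u} [CommRing A] (h : IsChainRing A) (a b : A) : a ∣ b ∨ b ∣ a := by
  rcases h (Ideal.span {a}) (Ideal.span {b}) with h | h
  · exact Or.inr (Ideal.span_singleton_le_span_singleton.1 h)
  · exact Or.inl (Ideal.span_singleton_le_span_singleton.1 h)

theorem chain_main' {A : Type u} [CommRing A] (hA : IsChainRing A)
    (hcs : IsCoherentRing A ∨ ¬ IsSemicoherentRing A) {E M : Type u} [AddCommGroup E]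
    [Module A E] [AddCommGroup M] [Module A M] (hE : Module.Baer A E)
    (hU : ∀ e e' : E, e ≠ 0 → e' ≠ 0 → ∃ r r' : A, r • e = r' • e' ∧ r • e ≠ 0)
    (T : Submonoid A) (g : E →ₗ[A] M) [hg : IsLocalizedModule T g] : Module.Baer A M := by
  have hA' := chain_dvd hA
  have hMb : ∀ s ∈ T, Function.Bijective (fun m : M => s • m) := by
    intro s hs
    exact (Module.End.isUnit_iff _).1 (hg.map_units ⟨s, hs⟩)
  by_cases h0 : (0 : A) ∈ T
  · have : ∀ m : M, m = 0 := by
      intro m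
      have := (hMb 0 h0).1 (a₁ := m) (a₂ := 0) (by simp)
      exact this
    exact fun I f => ⟨0, fun x hx => by rw [this (f _)]; rfl⟩
  let J : Ideal A :=
    { carrier := {j | ∀ c, c * j ∉ T}
      zero_mem' := by intro c; simpa using h0
      add_mem' := by
        intro a b ha hb c hc
        rcases hA' a b with ⟨d, rfl⟩ | ⟨d, rfl⟩
        · exact ha (c * (1 + d)) (by convert hc using 1; ring)
        · exact hb (c * (1 + d)) (by convert hc using 1; ring)
      smul_mem' := by
        intro x j hj c hc
        exact hj (c * x) (by convert hc using 1; simp [mul_assoc]) }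
  have hJmem : ∀ j, j ∉ J ↔ ∃ c, c * j ∈ T := by
    intro j
    change ¬ (∀ c, c * j ∉ T) ↔ _
    push Not
    rfl
  have hTJ : ∀ t ∈ T, t ∉ J := fun t ht => (hJmem t).2 ⟨1, by simpa using ht⟩
  have hJp : J.IsPrime := by
    refine ⟨fun h => hTJ 1 T.one_mem (h ▸ Submodule.mem_top), ?_⟩
    intro x y hxy
    by_contra hcon
    push Not at hcon
    obtain ⟨c, hc⟩ := (hJmem x).1 hcon.1
    obtain ⟨d, hd⟩ := (hJmem y).1 hcon.2
    exact (hJmem (x * y)).2 ⟨c * d, by convert T.mul_mem hc hd using 1; ring⟩ hxy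
  refine chain_main hA' hcs hE hU J g ⟨?_, ?_, ?_, ?_⟩
  · intro s hs m hm
    obtain ⟨c, hc⟩ := (hJmem s).1 hs
    exact (hMb _ hc).1 (by simp [mul_smul, hm])
  · intro s hs m
    obtain ⟨c, hc⟩ := (hJmem s).1 hs
    obtain ⟨m', hm'⟩ := (hMb _ hc).2 m
    exact ⟨c • m', by rw [smul_smul, mul_comm]; exact hm'⟩
  · intro e he
    obtain ⟨s, hs⟩ := (IsLocalizedModule.eq_zero_iff T g).1 he
    exact ⟨s, hTJ s s.2, hs⟩
  · intro m
    obtain ⟨⟨e, s⟩, h⟩ := IsLocalizedModule.surj T g m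
    exact ⟨s, hTJ s s.2, e, h⟩

end ChainMain
section Reduction

theorem exists_max_disjoint {R : Type u} [CommRing R] {E : Type u} [AddCommGroup E] [Module R E]
    (X Y : Submodule R E) (h : Disjoint X Y) :
    ∃ C : Submodule R E, Y ≤ C ∧ Disjoint X C ∧ ∀ D, C ≤ D → Disjoint X D → D ≤ C := by
  obtain ⟨C, hYC, hC⟩ := zorn_le_nonempty₀ {C : Submodule R E | Disjoint X C} (by
    intro c hc hchain y hy
    refine ⟨sSup c, ?_, fun z hz => le_sSup hz⟩
    rw [Set.mem_ofPred_eq, Submodule.disjoint_def]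
    intro x hx hxc
    obtain ⟨z, hz, hxz⟩ := (Submodule.mem_sSup_of_directed ⟨y, hy⟩ hchain.directedOn).1 hxc
    exact Submodule.disjoint_def.1 (hc hz) x hx hxz) Y h
  exact ⟨C, hYC, hC.1, fun D hCD hD => hC.2 hD hCD⟩

theorem indec_inj_uniform {R : Type u} [CommRing R] {E : Type u} [AddCommGroup E] [Module R E]
    (hE : Module.Injective R E) (hI : IsIndecomposableModule R E) (X Y : Submodule R E)
    (hX : X ≠ ⊥) (hY : Y ≠ ⊥) : ¬ Disjoint X Y := by
  intro hXY
  obtain ⟨C, hYC, hXC, hCmax⟩ := exists_max_disjoint X Y hXY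
  obtain ⟨X', hXX', hCX', hX'max⟩ := exists_max_disjoint C X hXC.symm
  have hinj : Function.Injective (LinearMap.coprod X'.subtype C.subtype) := by
    rw [injective_iff_map_eq_zero]
    rintro ⟨x, c⟩ h
    have h' : (x : E) + c = 0 := by simpa using h
    have hc : (c : E) = 0 := by
      apply Submodule.disjoint_def.1 hCX' c c.2
      rw [eq_neg_of_add_eq_zero_right h']
      exact X'.neg_mem x.2
    have hx : (x : E) = 0 := by rw [hc, add_zero] at h'; exact h'
    exact Prod.ext (Subtype.ext hx) (Subtype.ext hc)
  obtain ⟨h, hh⟩ := hE.out (LinearMap.coprod X'.subtype C.subtype) hinj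
    (X'.subtype ∘ₗ LinearMap.fst R X' C)
  have hx : ∀ x ∈ X', h x = x := by
    intro x hx
    have := hh (⟨x, hx⟩, 0)
    simpa using this
  have hc : ∀ c ∈ C, h c = 0 := by
    intro c hc
    have := hh (0, ⟨c, hc⟩)
    simpa using this
  have hW : C.comap h ≤ C := by
    apply hCmax
    · intro c hcC
      rw [Submodule.mem_comap, hc c hcC]
      exact C.zero_mem
    · rw [Submodule.disjoint_def]
      intro x hxX hxW
      rw [Submodule.mem_comap, hx x (hXX' hxX)] at hxW
      exact Submodule.disjoint_def.1 hXC x hxX hxW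
  have hR : LinearMap.range h ≤ X' := by
    apply hX'max
    · intro x hxX
      exact ⟨x, hx x hxX⟩
    · rw [Submodule.disjoint_def]
      rintro _ hyC ⟨e, rfl⟩
      exact hc e (hW hyC)
  have hcompl : IsCompl X' C := by
    refine ⟨hCX'.symm, ?_⟩
    rw [codisjoint_iff, eq_top_iff]
    intro e _
    rw [Submodule.mem_sup]
    refine ⟨h e, hR ⟨e, rfl⟩, e - h e, hW ?_, by abel⟩
    rw [Submodule.mem_comap, map_sub, hx (h e) (hR ⟨e, rfl⟩), sub_self]
    exact C.zero_mem
  rcases hI.2 X' C hcompl with h0 | h0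
  · exact hX (eq_bot_iff.2 (h0 ▸ hXX'))
  · exact hY (eq_bot_iff.2 (h0 ▸ hYC))

theorem indec_inj_uniform' {R : Type u} [CommRing R] {E : Type u} [AddCommGroup E] [Module R E]
    (hE : Module.Injective R E) (hI : IsIndecomposableModule R E) (e e' : E) (he : e ≠ 0)
    (he' : e' ≠ 0) : ∃ r r' : R, r • e = r' • e' ∧ r • e ≠ 0 := by
  have := indec_inj_uniform hE hI (Submodule.span R {e}) (Submodule.span R {e'})
    (by simpa using he) (by simpa using he')
  rw [Submodule.disjoint_def] at this
  push Not at this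
  obtain ⟨x, hx, hx', h0⟩ := this
  obtain ⟨r, rfl⟩ := Submodule.mem_span_singleton.1 hx
  obtain ⟨r', hr'⟩ := Submodule.mem_span_singleton.1 hx'
  exact ⟨r, r', hr'.symm, h0⟩

theorem injective_of_equiv {R : Type u} [CommRing R] {M N : Type u} [AddCommGroup M] [Module R M]
    [AddCommGroup N] [Module R N] (e : M ≃ₗ[R] N) (h : Module.Injective R M) :
    Module.Injective R N :=
  (Module.Baer.of_equiv e (Module.Baer.of_injective h)).injective

theorem injective_up {R : Type u} [CommRing R] (S : Submonoid R) (A : Type u) [CommRing A]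
    [Algebra R A] [IsLocalization S A] (M : Type u) [AddCommGroup M] [Module R M] [Module A M]
    [IsScalarTower R A M] (h : Module.Injective R M) : Module.Injective A M := by
  constructor
  intro X Y _ _ _ _ f hf g
  let _ : Module R X := Module.compHom X (algebraMap R A)
  let _ : Module R Y := Module.compHom Y (algebraMap R A)
  have : IsScalarTower R A X := IsScalarTower.of_algebraMap_smul fun _ _ => rfl
  have : IsScalarTower R A Y := IsScalarTower.of_algebraMap_smul fun _ _ => rfl
  obtain ⟨k, hk⟩ := h.out (f.restrictScalars R) hf (g.restrictScalars R)
  exact ⟨k.extendScalarsOfIsLocalization S A, hk⟩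

theorem injective_down {R : Type u} [CommRing R] (S : Submonoid R)
    (M : Type u) [AddCommGroup M] [Module R M] [Module (Localization S) M]
    [IsScalarTower R (Localization S) M] (h : Module.Injective (Localization S) M) :
    Module.Injective R M := by
  constructor
  intro X Y _ _ _ _ f hf g
  let A := Localization S
  have hM : ∀ x : S, IsUnit ((algebraMap R (Module.End R M)) x) := by
    intro x
    rw [Module.End.isUnit_iff]
    obtain ⟨v, hv⟩ := IsLocalization.map_units A x
    have : (fun m : M => (x : R) • m) = fun m => v • m := by
      ext m
      rw [← algebraMap_smul A, ← hv]; rfl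
    change Function.Bijective (fun m : M => (x : R) • m)
    rw [this]
    exact MulAction.bijective v
  let g' := (IsLocalizedModule.lift S (LocalizedModule.mkLinearMap S X) g hM)
  let f' := IsLocalizedModule.map S (LocalizedModule.mkLinearMap S X)
    (LocalizedModule.mkLinearMap S Y) f
  have hf' : Function.Injective f' := IsLocalizedModule.map_injective S _ _ f hf
  obtain ⟨k, hk⟩ := h.out (f'.extendScalarsOfIsLocalization S A) hf'
    (g'.extendScalarsOfIsLocalization S A)
  refine ⟨k.restrictScalars R ∘ₗ LocalizedModule.mkLinearMap S Y, fun x => ?_⟩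
  have h1 := hk (LocalizedModule.mkLinearMap S X x)
  have h2 : f' (LocalizedModule.mkLinearMap S X x) = LocalizedModule.mkLinearMap S Y (f x) :=
    IsLocalizedModule.map_apply _ _ _ _ _
  have h3 : g' (LocalizedModule.mkLinearMap S X x) = g x :=
    IsLocalizedModule.lift_apply _ _ _ _ _
  simp only [LinearMap.extendScalarsOfIsLocalization_apply'] at h1
  rw [h2, h3] at h1
  exact h1

theorem localized_indec {R : Type u} [CommRing R] (harith : IsArithmetical R)
    (ha : ∀ (P : Ideal R) (hP : P.IsMaximal),
      haveI := hP.isPrime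
      IsCoherentRing (Localization.AtPrime P) ∨ ¬ IsSemicoherentRing (Localization.AtPrime P))
    (S : Submonoid R) (E : Type u) [AddCommGroup E] [Module R E]
    (hE : Module.Injective R E) (hI : IsIndecomposableModule R E) :
    Module.Injective R (LocalizedModule S E) := by
  have hU := indec_inj_uniform' hE hI
  let P0 : Ideal R :=
    { carrier := {r | ∃ e : E, e ≠ 0 ∧ r • e = 0}
      zero_mem' := by
        obtain ⟨e, he⟩ := @exists_ne E hI.1 0
        exact ⟨e, he, zero_smul _ _⟩
      add_mem' := by
        rintro a b ⟨e, he, hae⟩ ⟨e', he', hbe⟩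
        obtain ⟨r, r', h, h0⟩ := hU e e' he he'
        refine ⟨r • e, h0, ?_⟩
        rw [add_smul, smul_comm a, hae, h, smul_comm b, hbe, smul_zero, smul_zero, add_zero]
      smul_mem' := by
        rintro c a ⟨e, he, hae⟩
        exact ⟨e, he, by rw [smul_eq_mul, mul_smul, hae, smul_zero]⟩ }
  have hP0 : P0 ≠ ⊤ := by
    rw [Ideal.ne_top_iff_one]
    rintro ⟨e, he, h⟩
    exact he (by simpa using h)
  obtain ⟨P, hP, hle⟩ := Ideal.exists_le_maximal P0 hP0
  have := hP.isPrime
  have hbij : ∀ r, r ∉ P → Function.Bijective (fun e : E => r • e) := by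
    intro r hr
    have hinj : Function.Injective (LinearMap.lsmul R E r) := by
      rw [injective_iff_map_eq_zero]
      intro e he
      by_contra h0
      exact hr (hle ⟨e, h0, he⟩)
    refine ⟨hinj, fun e => ?_⟩
    obtain ⟨k, hk⟩ := hE.out (LinearMap.lsmul R E r) hinj LinearMap.id
    exact ⟨k e, by simpa using hk e⟩
  let A := Localization.AtPrime P
  let E' := LocalizedModule P.primeCompl E
  have hmk : Function.Bijective (LocalizedModule.mkLinearMap P.primeCompl E) := by
    constructor
    · rw [injective_iff_map_eq_zero]
      intro e he
      obtain ⟨s, hs⟩ := (IsLocalizedModule.eq_zero_iff P.primeCompl _).1 he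
      exact (hbij s s.2).1 (hs.trans (smul_zero (s : R)).symm)
    · intro m
      obtain ⟨⟨e, s⟩, h⟩ := IsLocalizedModule.surj P.primeCompl
        (LocalizedModule.mkLinearMap P.primeCompl E) m
      obtain ⟨e', rfl⟩ := (hbij s s.2).2 e
      refine ⟨e', ?_⟩
      apply IsLocalizedModule.smul_injective (LocalizedModule.mkLinearMap P.primeCompl E) s
      simp only at h ⊢
      rw [h, map_smul]; rfl
  let eqv : E ≃ₗ[R] E' := LinearEquiv.ofBijective _ hmk
  have hE' : Module.Injective R E' := injective_of_equiv eqv hE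
  have hE'A : Module.Injective A E' := injective_up P.primeCompl A E' hE'
  have hU' : ∀ e e' : E', e ≠ 0 → e' ≠ 0 → ∃ r r' : A, r • e = r' • e' ∧ r • e ≠ 0 := by
    intro e e' he he'
    obtain ⟨x, rfl⟩ := eqv.surjective e
    obtain ⟨x', rfl⟩ := eqv.surjective e'
    obtain ⟨r, r', h, h0⟩ := hU x x' (fun h => he (by rw [h, map_zero]))
      (fun h => he' (by rw [h, map_zero]))
    refine ⟨algebraMap R A r, algebraMap R A r', ?_, ?_⟩
    · rw [algebraMap_smul, algebraMap_smul, ← map_smul, h, map_smul]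
    · rw [algebraMap_smul, ← map_smul]
      exact fun h => h0 (eqv.injective (by rw [h, map_zero]))
  let T := Algebra.algebraMapSubmonoid A S
  let M' := LocalizedModule T E'
  let g := LocalizedModule.mkLinearMap T E'
  have hM' : Module.Injective A M' :=
    (chain_main' (harith P hP) (ha P hP) (Module.Baer.of_injective hE'A) hU' T g).injective
  have : IsScalarTower R A M' := inferInstance
  have hM'R : Module.Injective R M' := injective_down P.primeCompl M' hM'
  have h1 : IsLocalizedModule S (g.restrictScalars R) := IsLocalizedModule.restrictScalars S g
  have h2 : IsLocalizedModule S (g.restrictScalars R ∘ₗ (eqv : E →ₗ[R] E')) := inferInstance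
  exact injective_of_equiv (IsLocalizedModule.iso S
    (g.restrictScalars R ∘ₗ (eqv : E →ₗ[R] E'))).symm hM'R

theorem localized_sum {R : Type u} [CommRing R] (harith : IsArithmetical R)
    (ha : ∀ (P : Ideal R) (hP : P.IsMaximal),
      haveI := hP.isPrime
      IsCoherentRing (Localization.AtPrime P) ∨ ¬ IsSemicoherentRing (Localization.AtPrime P))
    (S : Submonoid R) (E : Type u) [AddCommGroup E] [Module R E]
    (n : ℕ) (D : Fin n → Submodule R E) (hD : DirectSum.IsInternal D)
    (hDi : ∀ i, Module.Injective R (D i) ∧ IsIndecomposableModule R (D i)) :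
    Module.Injective R (LocalizedModule S E) := by
  have : ∀ i, Module.Injective R (LocalizedModule S (D i)) := fun i =>
    localized_indec harith ha S (D i) (hDi i).1 (hDi i).2
  have hpi : Module.Injective R (∀ i, LocalizedModule S (D i)) := inferInstance
  let e1 : (DirectSum (Fin n) fun i => D i) ≃ₗ[R] E :=
    LinearEquiv.ofBijective (DirectSum.coeLinearMap D) hD
  let e2 : (DirectSum (Fin n) fun i => D i) ≃ₗ[R] (∀ i, D i) :=
    DirectSum.linearEquivFunOnFintype R (Fin n) fun i => D i
  let eqv : E ≃ₗ[R] (∀ i, D i) := e1.symm.trans e2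
  let f : (∀ i, D i) →ₗ[R] (∀ i, LocalizedModule S (D i)) :=
    LinearMap.pi fun i => LocalizedModule.mkLinearMap S (D i) ∘ₗ LinearMap.proj i
  have h1 : IsLocalizedModule S f :=
    IsLocalizedModule.pi S (fun i => LocalizedModule.mkLinearMap S (D i))
  have h2 : IsLocalizedModule S (f ∘ₗ (eqv : E →ₗ[R] (∀ i, D i))) := inferInstance
  exact injective_of_equiv (IsLocalizedModule.iso S
    (f ∘ₗ (eqv : E →ₗ[R] (∀ i, D i)))).symm hpi

end Reduction

/-- Let `R` be an arithmetical ring such that (a) each `R_P` is coherent or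
not semicoherent, and (b) every finitely generated module has finite Goldie dimension.  Then
the localization of any finitely injective module `G` at a multiplicative subset `S` is a
finitely injective `S⁻¹R`-module. -/
theorem localization_finitelyInjective (R : Type u) [CommRing R]
    (harith : IsArithmetical R)
    (ha : ∀ (P : Ideal R) (hP : P.IsMaximal),
      haveI := hP.isPrime
      IsCoherentRing (Localization.AtPrime P) ∨ ¬ IsSemicoherentRing (Localization.AtPrime P))
    (hb : ∀ (M : Type u) [AddCommGroup M] [Module R M],
      Module.Finite R M → HasFiniteGoldieDimension R M)
    (S : Submonoid R) (G : Type u) [AddCommGroup G] [Module R G]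
    (hG : IsFinitelyInjective R G) :
    IsFinitelyInjective (Localization S) (LocalizedModule S G) := by
  intro B _ _ A hA f
  obtain ⟨t, ht⟩ := (Submodule.fg_top A).2 hA
  have hfrac : ∀ a : A, ∃ (x : G) (s : S), f a = LocalizedModule.mk x s := by
    intro a
    induction h : f a using LocalizedModule.induction_on with
    | h m s => exact ⟨m, s, rfl⟩
  choose x s hxs using hfrac
  let M : Submodule R G := Submodule.span R (x '' (t : Set A))
  have hMfin : Module.Finite R M :=
    Module.Finite.iff_fg.2 (Submodule.fg_span (t.finite_toSet.image x))
  obtain ⟨E, ι, ⟨hE, hι, -⟩, n, D, hD, hDi⟩ := hb M hMfin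
  have hSE : Module.Injective (Localization S) (LocalizedModule S E) :=
    injective_up S (Localization S) _ (localized_sum harith ha S E n D hD hDi)
  -- extend the inclusion of `M` to `E`
  let ιe : M ≃ₗ[R] LinearMap.range ι := LinearEquiv.ofInjective ι hι
  have hfg : (LinearMap.range ι).FG := by
    rw [LinearMap.range_eq_map]
    exact hMfin.fg_top.map ι
  obtain ⟨φ, hφ⟩ := hG E (LinearMap.range ι) hfg (M.subtype ∘ₗ (ιe.symm : _ →ₗ[R] M))
  have hφι : φ ∘ₗ ι = M.subtype := by
    ext m
    have := hφ (ιe m)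
    simpa [ιe] using this
  let L : LocalizedModule S M →ₗ[Localization S] LocalizedModule S G :=
    LocalizedModule.map S M.subtype
  have hL : Function.Injective L := LocalizedModule.map_injective S _ M.injective_subtype
  have hrange : ∀ a, f a ∈ LinearMap.range L := by
    intro a
    have h1 : Submodule.span (Localization S) (t : Set A) ≤ (LinearMap.range L).comap f := by
      rw [Submodule.span_le]
      intro b hb'
      refine ⟨LocalizedModule.mk ⟨x b, Submodule.subset_span ⟨b, hb', rfl⟩⟩ (s b), ?_⟩
      rw [hxs b]
      exact LocalizedModule.map_mk S _ _ _
    exact h1 (ht ▸ Submodule.mem_top)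
  let Le := LinearEquiv.ofInjective L hL
  let f1 : A →ₗ[Localization S] LocalizedModule S M :=
    (Le.symm : _ →ₗ[Localization S] _) ∘ₗ f.codRestrict (LinearMap.range L) hrange
  have hf1 : ∀ a, L (f1 a) = f a := by
    intro a
    have : Le (f1 a) = f.codRestrict (LinearMap.range L) hrange a := by simp [f1]
    exact congrArg Subtype.val this
  let ιS : LocalizedModule S M →ₗ[Localization S] LocalizedModule S E := LocalizedModule.map S ι
  let φS : LocalizedModule S E →ₗ[Localization S] LocalizedModule S G := LocalizedModule.map S φ
  have hcomp : ∀ z, φS (ιS z) = L z := by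
    intro z
    induction z using LocalizedModule.induction_on with
    | h m s =>
      simp only [φS, ιS, L, LocalizedModule.map_mk, ← hφι]
      rfl
  obtain ⟨k, hk⟩ := hSE.out A.subtype A.injective_subtype (ιS ∘ₗ f1)
  refine ⟨φS ∘ₗ k, fun a => ?_⟩
  have := hk a
  simp only [Submodule.subtype_apply, LinearMap.comp_apply] at this ⊢
  rw [this, hcomp, hf1]
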